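/- arXiv:2511.14115 — 2 statements merged into one kernel-verified Lean document; each statement's English description precedes it below -/
import Mathlib

section
/- Let N ≥ 5 be an integer, 2* = 2N/(N−2), m ∈ [2, N−2), τ1 = (N−2−m)/(N−2), and r0 > 0. Then there exist a constant C > 0 and an integer k0 such that for every integer k ≥ k0, setting μ = k^{1/τ1} and σ_k = k^{1/(N−2)}, for every r ∈ [r0 μ − 1, r0 μ + 1], the function ϖ_{r,N−2}(y) = Σ_{i=1}^k (1 + |y − x^i|)^{−(N−2)} (which is smooth on ℝ^N ∖ {x^1,…,x^k}) satisfies, at every point y ∈ ℝ^N ∖ P_1: −Δϖ_{r,N−2}(y) ≥ C σ_k^{1 − 4τ1/(N−2)} ϖ_{r,N−2}(y)^{2*−1}, where Δ is the classical Laplacian. -/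
noncomputable section

/-- The classical Laplacian of `f : ℝ^N → ℝ`, as the sum of the second partial
derivatives in the coordinate directions. -/
noncomputable def laplacian {N : ℕ} (f : EuclideanSpace ℝ (Fin N) → ℝ)
    (y : EuclideanSpace ℝ (Fin N)) : ℝ :=
  ∑ i : Fin N,
    fderiv ℝ (fun z => fderiv ℝ f z (EuclideanSpace.single i 1)) y
      (EuclideanSpace.single i 1)

/-- The `i`-th of `k` equally spaced points on the circle of radius `r`
in the `(y₁,y₂)`-plane of `ℝ^N` (here `i = 1, …, k`). -/
noncomputable def circlePt (N k : ℕ) (r : ℝ) (i : ℕ) : EuclideanSpace ℝ (Fin N) :=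
  WithLp.toLp 2 fun j : Fin N =>
    if (j : ℕ) = 0 then r * Real.cos (2 * Real.pi * ((i : ℝ) - 1) / k)
    else if (j : ℕ) = 1 then r * Real.sin (2 * Real.pi * ((i : ℝ) - 1) / k)
    else 0

/-- The barrier function `ϖ_{r,α}(y) = Σ_{i=1}^k (1 + |y − x^i|)^{−α}`. -/
noncomputable def varpi (N k : ℕ) (r α : ℝ) (y : EuclideanSpace ℝ (Fin N)) : ℝ :=
  ∑ i ∈ Finset.Icc 1 k, (1 + ‖y - circlePt N k r i‖) ^ (-α)

lemma hasFDerivAt_norm_sub {E : Type*} [NormedAddCommGroup E] [InnerProductSpace ℝ E]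
    {c y : E} (h : y ≠ c) :
    HasFDerivAt (fun z => ‖z - c‖) (‖y - c‖⁻¹ • innerSL ℝ (y - c)) y := by
  have hpos : 0 < ‖y - c‖ := norm_pos_iff.2 (sub_ne_zero.2 h)
  have hsq := ((hasFDerivAt_id (𝕜 := ℝ) y).sub_const c).norm_sq
  have hsqrt := hsq.sqrt (by simpa using sub_ne_zero.2 h)
  simp only [id, Real.sqrt_sq (norm_nonneg _)] at hsqrt
  convert! hsqrt using 1
  ext v
  simp
  field_simp

/-- The Laplacian of a sum of functions that are radial about the points `c i`. -/
lemma laplacian_sum_radial {N : ℕ} {ι : Type*} (s : Finset ι) (c : ι → EuclideanSpace ℝ (Fin N))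
    {φ φ' φ'' : ℝ → ℝ} (h1 : ∀ ρ, 0 < ρ → HasDerivAt φ (φ' ρ) ρ)
    (h2 : ∀ ρ, 0 < ρ → HasDerivAt φ' (φ'' ρ) ρ)
    {y : EuclideanSpace ℝ (Fin N)} (hy : ∀ i ∈ s, y ≠ c i) :
    laplacian (fun z => ∑ i ∈ s, φ ‖z - c i‖) y =
      ∑ i ∈ s, (φ'' ‖y - c i‖ + ((N : ℝ) - 1) / ‖y - c i‖ * φ' ‖y - c i‖) := by
  have hgrad (z : EuclideanSpace ℝ (Fin N)) (hz : ∀ i ∈ s, z ≠ c i) (e : Fin N) :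
      fderiv ℝ (fun z => ∑ i ∈ s, φ ‖z - c i‖) z (EuclideanSpace.single e 1) =
        ∑ i ∈ s, φ' ‖z - c i‖ * ‖z - c i‖⁻¹ * (z - c i) e := by
    have hd : HasFDerivAt (fun z => ∑ i ∈ s, φ ‖z - c i‖)
        (∑ i ∈ s, φ' ‖z - c i‖ • (‖z - c i‖⁻¹ • innerSL ℝ (z - c i))) z :=
      HasFDerivAt.fun_sum fun i hi =>
        (h1 _ (norm_pos_iff.2 (sub_ne_zero.2 (hz i hi)))).comp_hasFDerivAt z
          (hasFDerivAt_norm_sub (hz i hi))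
    rw [hd.fderiv]
    simp [EuclideanSpace.inner_single_right, mul_assoc]
  have hnear : ∀ᶠ z in nhds y, ∀ i ∈ s, z ≠ c i :=
    (Finset.eventually_all s).2 fun i hi => isOpen_ne.mem_nhds (hy i hi)
  have hsecond (e : Fin N) :
      fderiv ℝ (fun z => fderiv ℝ (fun z => ∑ i ∈ s, φ ‖z - c i‖) z
          (EuclideanSpace.single e 1)) y (EuclideanSpace.single e 1) =
        ∑ i ∈ s, ((φ'' ‖y - c i‖ * ‖y - c i‖⁻¹ - φ' ‖y - c i‖ * (‖y - c i‖ ^ 2)⁻¹) *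
          ‖y - c i‖⁻¹ * (y - c i) e ^ 2 + φ' ‖y - c i‖ * ‖y - c i‖⁻¹) := by
    rw [Filter.EventuallyEq.fderiv_eq (hnear.mono fun z hz => hgrad z hz e)]
    have hd : HasFDerivAt
        (fun z => ∑ i ∈ s, φ' ‖z - c i‖ * ‖z - c i‖⁻¹ * (z - c i) e) _ y :=
      HasFDerivAt.fun_sum fun i hi => by
        have hpos := norm_pos_iff.2 (sub_ne_zero.2 (hy i hi))
        exact (((h2 _ hpos).mul (hasDerivAt_inv hpos.ne')).comp_hasFDerivAt y
          (hasFDerivAt_norm_sub (hy i hi))).mul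
          ((EuclideanSpace.proj (𝕜 := ℝ) e).hasFDerivAt.comp y
            ((hasFDerivAt_id (𝕜 := ℝ) y).sub_const (c i)))
    rw [hd.fderiv]
    simp only [sum_apply]
    refine Finset.sum_congr rfl fun i hi => ?_
    simp [EuclideanSpace.inner_single_right]
    ring
  unfold laplacian
  rw [Finset.sum_congr rfl fun e _ => hsecond e, Finset.sum_comm]
  refine Finset.sum_congr rfl fun i hi => ?_
  have hpos := norm_pos_iff.2 (sub_ne_zero.2 (hy i hi))
  rw [Finset.sum_add_distrib, ← Finset.mul_sum, ← EuclideanSpace.real_norm_sq_eq]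
  simp only [Finset.sum_const, Finset.card_univ, Fintype.card_fin, nsmul_eq_mul]
  field_simp
  ring

lemma neg_laplacian_varpi {N k : ℕ} {r : ℝ} {y : EuclideanSpace ℝ (Fin N)}
    (hy : ∀ i ∈ Finset.Icc 1 k, y ≠ circlePt N k r i) :
    -laplacian (varpi N k r ((N : ℝ) - 2)) y =
      ((N : ℝ) - 2) * ((N : ℝ) - 1) * ∑ i ∈ Finset.Icc 1 k,
        (1 + ‖y - circlePt N k r i‖) ^ (-(N : ℝ)) / ‖y - circlePt N k r i‖ := by
  have hder (a ρ : ℝ) (hρ : 0 < ρ) :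
      HasDerivAt (fun t : ℝ => (1 + t) ^ a) (a * (1 + ρ) ^ (a - 1)) ρ := by
    simpa using ((hasDerivAt_id ρ).const_add 1).rpow_const (p := a) (Or.inl (by simp; positivity))
  have hl := laplacian_sum_radial (Finset.Icc 1 k) (circlePt N k r)
    (φ := fun t => (1 + t) ^ (-((N : ℝ) - 2))) (hder _)
    (fun ρ hρ => (hder (-((N : ℝ) - 2) - 1) ρ hρ).const_mul (-((N : ℝ) - 2))) hy
  change -laplacian (fun z => ∑ i ∈ Finset.Icc 1 k,
    (1 + ‖z - circlePt N k r i‖) ^ (-((N : ℝ) - 2))) y = _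
  rw [hl, ← Finset.sum_neg_distrib, Finset.mul_sum]
  refine Finset.sum_congr rfl fun i hi => ?_
  have hpos := norm_pos_iff.2 (sub_ne_zero.2 (hy i hi))
  set ρ := ‖y - circlePt N k r i‖
  have e1 : -((N : ℝ) - 2) - 1 = -(N : ℝ) + 1 := by ring
  have e2 : -((N : ℝ) - 2) - 1 - 1 = -(N : ℝ) := by ring
  rw [e2, e1, Real.rpow_add_one (by positivity)]
  field_simp
  ring

lemma sum_rpow_neg_rpow_le {ι : Type*} (s : Finset ι) {a : ι → ℝ} (ha : ∀ i, 0 < a i)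
    {n : ℝ} (hn : 0 < n) :
    (∑ i ∈ s, a i ^ (-n)) ^ (1 + 4 / n) ≤
      (∑ i ∈ s, a i ^ (-(n / 4))) ^ (4 / n) * ∑ i ∈ s, a i ^ (-(n + 3)) := by
  have hp : (1 : ℝ) ≤ 1 + 4 / n := le_add_of_nonneg_right (by positivity)
  have hp0 : (1 + 4 / n) ≠ 0 := by positivity
  have h := Real.inner_le_weight_mul_Lp_of_nonneg s hp (fun i => a i ^ (-(n / 4)))
    (fun i => a i ^ (-(3 * n / 4))) (fun i => (Real.rpow_pos_of_pos (ha i) _).le)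
    (fun i => (Real.rpow_pos_of_pos (ha i) _).le)
  have hnn (b : ℝ) : 0 ≤ ∑ i ∈ s, a i ^ b :=
    Finset.sum_nonneg fun i _ => (Real.rpow_pos_of_pos (ha i) _).le
  have e1 (i : ι) : a i ^ (-(n / 4)) * a i ^ (-(3 * n / 4)) = a i ^ (-n) := by
    rw [← Real.rpow_add (ha i)]; congr 1; ring
  have e2 (i : ι) : a i ^ (-(n / 4)) * (a i ^ (-(3 * n / 4))) ^ (1 + 4 / n) =
      a i ^ (-(n + 3)) := by
    rw [← Real.rpow_mul (ha i).le, ← Real.rpow_add (ha i)]; congr 1; field_simp; ring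
  simp only [e1, e2] at h
  have h' := Real.rpow_le_rpow (hnn _) h (by positivity : 0 ≤ 1 + 4 / n)
  rw [Real.mul_rpow (Real.rpow_nonneg (hnn _) _) (Real.rpow_nonneg (hnn _) _),
    ← Real.rpow_mul (hnn _), ← Real.rpow_mul (hnn _), inv_mul_cancel₀ hp0, Real.rpow_one] at h'
  convert h' using 3
  field_simp
  ring

lemma sum_Icc_rpow_neg_le {τ : ℝ} (h0 : 0 ≤ τ) (h1 : τ < 1) (n : ℕ) :
    ∑ j ∈ Finset.Icc 1 n, (j : ℝ) ^ (-τ) ≤ (n : ℝ) ^ (1 - τ) / (1 - τ) := by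
  induction n with
  | zero => simp [Real.zero_rpow (by linarith : 1 - τ ≠ 0)]
  | succ n ih =>
    rw [Finset.sum_Icc_succ_top (by omega)]
    have hpos : (0 : ℝ) < (n + 1 : ℕ) := by positivity
    have hb := rpow_one_add_le_one_add_mul_self (s := -((n + 1 : ℕ) : ℝ)⁻¹) (p := 1 - τ)
      (by rw [neg_le_neg_iff]
          exact inv_le_one_of_one_le₀ (by push_cast; linarith [Nat.cast_nonneg (α := ℝ) n]))
      (by linarith) (by linarith)
    have e : 1 + -((n + 1 : ℕ) : ℝ)⁻¹ = n / (n + 1 : ℕ) := by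
      push_cast; field_simp; ring
    rw [e, Real.div_rpow (by positivity) (by positivity), div_le_iff₀ (by positivity)] at hb
    have e2 : ((n + 1 : ℕ) : ℝ) ^ (1 - τ) = (n + 1 : ℕ) * ((n + 1 : ℕ) : ℝ) ^ (-τ) := by
      rw [sub_eq_add_neg, Real.rpow_add hpos, Real.rpow_one]
    have h1' : 0 < 1 - τ := by linarith
    rw [le_div_iff₀ h1'] at ih ⊢
    rw [e2] at hb ⊢
    have e3 : ((1 : ℝ) + (1 - τ) * -((n + 1 : ℕ) : ℝ)⁻¹) *
        ((n + 1 : ℕ) * ((n + 1 : ℕ) : ℝ) ^ (-τ)) =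
        (n + 1 : ℕ) * ((n + 1 : ℕ) : ℝ) ^ (-τ) - (1 - τ) * ((n + 1 : ℕ) : ℝ) ^ (-τ) := by
      field_simp
      ring
    rw [e3] at hb
    linarith

lemma sum_erase_dist_le {k i₀ : ℕ} (hi₀ : i₀ ∈ Finset.Icc 1 k) {g : ℕ → ℝ} (hg : ∀ j, 0 ≤ g j) :
    ∑ i ∈ (Finset.Icc 1 k).erase i₀, g (Nat.dist i i₀) ≤ 2 * ∑ j ∈ Finset.Icc 1 (k - 1), g j := by
  rw [Finset.mem_Icc] at hi₀
  have hsplit : (Finset.Icc 1 k).erase i₀ = Finset.Ico 1 i₀ ∪ Finset.Ioc i₀ k := by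
    ext i; simp only [Finset.mem_erase, Finset.mem_Icc, Finset.mem_union, Finset.mem_Ico,
      Finset.mem_Ioc]; omega
  have hdisj : Disjoint (Finset.Ico 1 i₀) (Finset.Ioc i₀ k) := by
    rw [Finset.disjoint_left]; intro i; simp only [Finset.mem_Ico, Finset.mem_Ioc]; omega
  have hinj {s : Finset ℕ} (hs : ∀ i ∈ s, Nat.dist i i₀ ∈ Finset.Icc 1 (k - 1))
      (hi : Set.InjOn (fun i => Nat.dist i i₀) s) :
      ∑ i ∈ s, g (Nat.dist i i₀) ≤ ∑ j ∈ Finset.Icc 1 (k - 1), g j := by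
    rw [← Finset.sum_image (f := g) hi]
    exact Finset.sum_le_sum_of_subset_of_nonneg (Finset.image_subset_iff.2 hs)
      fun j _ _ => hg j
  rw [hsplit, Finset.sum_union hdisj, two_mul]
  refine add_le_add (hinj ?_ ?_) (hinj ?_ ?_)
  · intro i hi; simp only [Finset.mem_Ico, Finset.mem_Icc, Nat.dist] at *; omega
  · intro i hi j hj h
    simp only [Finset.coe_Ico, Set.mem_Ico, Nat.dist] at *; omega
  · intro i hi; simp only [Finset.mem_Ioc, Finset.mem_Icc, Nat.dist] at *; omega
  · intro i hi j hj h
    simp only [Finset.coe_Ioc, Set.mem_Ioc, Nat.dist] at *; omega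

lemma two_mul_min_div_le_sin {k j : ℕ} (hj : j ≤ k) (hk : 0 < k) :
    2 * min (j : ℝ) (k - j) / k ≤ Real.sin (Real.pi * j / k) := by
  have hk' : (0 : ℝ) < k := by exact_mod_cast hk
  have hj' : (j : ℝ) ≤ k := by exact_mod_cast hj
  have hpi := Real.pi_pos
  rcases le_total (2 * (j : ℝ)) k with h | h
  · rw [min_eq_left (by linarith)]
    refine le_of_eq_of_le ?_ (Real.mul_le_sin (by positivity) ?_)
    · field_simp
    · rw [div_le_div_iff₀ hk' two_pos]; nlinarith
  · rw [min_eq_right (by linarith), ← Real.sin_pi_sub]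
    have e : Real.pi - Real.pi * j / k = Real.pi * (k - j) / k := by field_simp
    rw [e]
    refine le_of_eq_of_le ?_ (Real.mul_le_sin ?_ ?_)
    · field_simp
    · have : 0 ≤ (k : ℝ) - j := by linarith
      positivity
    · rw [div_le_div_iff₀ hk' two_pos]; nlinarith

lemma le_norm_circlePt_sub {N : ℕ} (hN : 2 ≤ N) (k : ℕ) (r : ℝ) (i j : ℕ) :
    2 * r * |Real.sin (Real.pi * ((i : ℝ) - j) / k)| ≤
      ‖circlePt N k r i - circlePt N k r j‖ := by
  refine le_of_abs_le (abs_le_of_sq_le_sq ?_ (norm_nonneg _))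
  set a : Fin N := ⟨0, by omega⟩
  set b : Fin N := ⟨1, by omega⟩
  have hab : a ≠ b := by simp [a, b]
  rw [EuclideanSpace.real_norm_sq_eq]
  refine le_trans (le_of_eq ?_) (Finset.sum_le_sum_of_subset_of_nonneg
    (Finset.subset_univ {a, b}) fun e _ _ => sq_nonneg _)
  rw [Finset.sum_pair hab]
  simp only [circlePt, PiLp.sub_apply, a, b, if_true, one_ne_zero, if_false]
  set s := 2 * Real.pi * ((i : ℝ) - 1) / k
  set t := 2 * Real.pi * ((j : ℝ) - 1) / k
  have e : Real.pi * ((i : ℝ) - j) / k = (s - t) / 2 := by simp only [s, t]; ring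
  have hcos : Real.cos (s - t) = 1 - 2 * Real.sin ((s - t) / 2) ^ 2 := by
    have h := Real.cos_two_mul ((s - t) / 2)
    rw [mul_div_cancel₀ _ (two_ne_zero)] at h
    rw [h, Real.cos_sq']; ring
  rw [Real.cos_sub] at hcos
  rw [e, mul_pow, sq_abs]
  nlinarith [Real.sin_sq_add_cos_sq s, Real.sin_sq_add_cos_sq t]

lemma abs_sin_dist (k i j : ℕ) :
    |Real.sin (Real.pi * ((i : ℝ) - j) / k)| = |Real.sin (Real.pi * (Nat.dist i j : ℕ) / k)| := by
  rcases le_total i j with h | h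
  · rw [Nat.dist_eq_sub_of_le h, Nat.cast_sub h, ← abs_neg, ← Real.sin_neg]
    congr 2; ring
  · rw [Nat.dist_eq_sub_of_le_right h, Nat.cast_sub h]

/-- If `i₀` indexes the nearest of the points `x^i` to `y`, then `y` is at least as far from `x^i`
as a fixed fraction of the circular distance between `i` and `i₀`. -/
lemma le_norm_sub_circlePt {N k : ℕ} (hN : 2 ≤ N) {r : ℝ} (hr : 0 ≤ r) {i i₀ : ℕ}
    (hi : i ∈ Finset.Icc 1 k) (hi₀ : i₀ ∈ Finset.Icc 1 k) {y : EuclideanSpace ℝ (Fin N)}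
    (hmin : ‖y - circlePt N k r i₀‖ ≤ ‖y - circlePt N k r i‖) :
    2 * r / k * min (Nat.dist i i₀ : ℝ) (k - Nat.dist i i₀) ≤ ‖y - circlePt N k r i‖ := by
  rw [Finset.mem_Icc] at hi hi₀
  have htri : ‖circlePt N k r i - circlePt N k r i₀‖ ≤
      ‖y - circlePt N k r i₀‖ + ‖y - circlePt N k r i‖ := by
    have h := norm_sub_le (y - circlePt N k r i₀) (y - circlePt N k r i)
    rwa [sub_sub_sub_cancel_left] at h
  have hchord := le_norm_circlePt_sub hN k r i i₀
  rw [abs_sin_dist] at hchord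
  have hsin := (two_mul_min_div_le_sin (k := k) (j := Nat.dist i i₀)
    (by simp only [Nat.dist]; omega) (by omega)).trans (le_abs_self _)
  have h := mul_le_mul_of_nonneg_left hsin hr
  calc _ = r * (2 * min (Nat.dist i i₀ : ℝ) (k - Nat.dist i i₀) / k) := by ring
    _ ≤ _ := by linarith

lemma sum_rpow_neg_norm_sub_circlePt_le {N k : ℕ} (hN : 2 ≤ N) (hk : 0 < k) {r τ : ℝ}
    (hr : 0 < r) (h0 : 0 < τ) (h1 : τ < 1) (y : EuclideanSpace ℝ (Fin N)) :
    ∑ i ∈ Finset.Icc 1 k, (1 + ‖y - circlePt N k r i‖) ^ (-τ) ≤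
      1 + 4 * ((2 * r / k) ^ (-τ) * ((k : ℝ) ^ (1 - τ) / (1 - τ))) := by
  obtain ⟨i₀, hi₀, hmin⟩ := Finset.exists_min_image (Finset.Icc 1 k)
    (fun i => ‖y - circlePt N k r i‖) ⟨1, Finset.mem_Icc.2 ⟨le_rfl, hk⟩⟩
  have hk' : (0 : ℝ) < k := by exact_mod_cast hk
  set A : ℝ := 2 * r / k with hA
  have hApos : 0 < A := by positivity
  set g : ℕ → ℝ := fun j => A ^ (-τ) * ((j : ℝ) ^ (-τ) + ((k - j : ℕ) : ℝ) ^ (-τ)) with hgdef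
  have hg (j : ℕ) : 0 ≤ g j := by positivity
  have hterm (i : ℕ) (hi : i ∈ (Finset.Icc 1 k).erase i₀) :
      (1 + ‖y - circlePt N k r i‖) ^ (-τ) ≤ g (Nat.dist i i₀) := by
    obtain ⟨hne, hi⟩ := Finset.mem_erase.1 hi
    have hlow := le_norm_sub_circlePt hN hr.le hi hi₀ (hmin i hi)
    rw [Finset.mem_Icc] at hi
    rw [Finset.mem_Icc] at hi₀
    have hj1 : 0 < Nat.dist i i₀ := Nat.dist_pos_of_ne hne
    have hjk : Nat.dist i i₀ < k := by simp only [Nat.dist]; omega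
    simp only [hgdef]
    set j := Nat.dist i i₀
    rw [← Nat.cast_sub hjk.le, ← hA] at hlow
    have hj1' : (0 : ℝ) < j := by exact_mod_cast hj1
    have hjk' : (0 : ℝ) < (k - j : ℕ) := by exact_mod_cast Nat.sub_pos_of_lt hjk
    have hminpos : 0 < min (j : ℝ) ((k - j : ℕ) : ℝ) := lt_min hj1' hjk'
    calc (1 + ‖y - circlePt N k r i‖) ^ (-τ)
        ≤ (A * min (j : ℝ) ((k - j : ℕ) : ℝ)) ^ (-τ) :=
          Real.rpow_le_rpow_of_nonpos (by positivity) (by linarith) (by linarith)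
      _ = A ^ (-τ) * (min (j : ℝ) ((k - j : ℕ) : ℝ)) ^ (-τ) :=
          Real.mul_rpow hApos.le hminpos.le
      _ ≤ _ := by
          gcongr
          rcases min_choice (j : ℝ) ((k - j : ℕ) : ℝ) with h | h <;> rw [h]
          · exact le_add_of_nonneg_right (by positivity)
          · exact le_add_of_nonneg_left (by positivity)
  have hreflect : ∑ j ∈ Finset.Icc 1 (k - 1), ((k - j : ℕ) : ℝ) ^ (-τ) =
      ∑ j ∈ Finset.Icc 1 (k - 1), (j : ℝ) ^ (-τ) := by
    refine Finset.sum_nbij' (fun j => k - j) (fun j => k - j) ?_ ?_ ?_ ?_ fun _ _ => rfl <;>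
      intro j hj <;> simp only [Finset.mem_Icc] at * <;> omega
  have hharm : ∑ j ∈ Finset.Icc 1 (k - 1), (j : ℝ) ^ (-τ) ≤ (k : ℝ) ^ (1 - τ) / (1 - τ) :=
    (Finset.sum_le_sum_of_subset_of_nonneg (Finset.Icc_subset_Icc_right (Nat.sub_le k 1))
      fun j _ _ => by positivity).trans (sum_Icc_rpow_neg_le h0.le h1 k)
  rw [← Finset.add_sum_erase _ _ hi₀]
  refine add_le_add (Real.rpow_le_one_of_one_le_of_nonpos
    (le_add_of_nonneg_right (norm_nonneg _)) (by linarith)) ?_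
  calc _ ≤ ∑ i ∈ (Finset.Icc 1 k).erase i₀, g (Nat.dist i i₀) := Finset.sum_le_sum hterm
    _ ≤ 2 * ∑ j ∈ Finset.Icc 1 (k - 1), g j := sum_erase_dist_le hi₀ hg
    _ = 4 * (A ^ (-τ) * ∑ j ∈ Finset.Icc 1 (k - 1), (j : ℝ) ^ (-τ)) := by
      simp only [hgdef]
      rw [← Finset.mul_sum, Finset.sum_add_distrib, hreflect]
      ring
    _ ≤ _ := by gcongr

lemma sum_rpow_neg_le_of_le_radius {N k : ℕ} (hN : 2 ≤ N) (hk : 0 < k) {r r0 τ : ℝ}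
    (hr0 : 0 < r0) (h0 : 0 < τ) (h1 : τ < 1) (hr : r0 * (k : ℝ) ^ (1 / τ) ≤ 2 * r)
    (y : EuclideanSpace ℝ (Fin N)) :
    ∑ i ∈ Finset.Icc 1 k, (1 + ‖y - circlePt N k r i‖) ^ (-τ) ≤
      1 + 4 * (r0 ^ (-τ) / (1 - τ)) := by
  have hk' : (0 : ℝ) < k := by exact_mod_cast hk
  have h1' : 0 < 1 - τ := by linarith
  have hpos : 0 < r0 * (k : ℝ) ^ (1 / τ) := by positivity
  refine (sum_rpow_neg_norm_sub_circlePt_le hN hk (by linarith) h0 h1 y).trans ?_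
  rw [← mul_div_assoc]
  gcongr
  calc (2 * r / k) ^ (-τ) * (k : ℝ) ^ (1 - τ)
      ≤ (r0 * (k : ℝ) ^ (1 / τ) / k) ^ (-τ) * (k : ℝ) ^ (1 - τ) := by
        refine mul_le_mul_of_nonneg_right (Real.rpow_le_rpow_of_nonpos (by positivity) ?_
          (by linarith)) (by positivity)
        gcongr
    _ = r0 ^ (-τ) := by
        rw [mul_div_assoc, Real.mul_rpow hr0.le (by positivity),
          ← Real.rpow_sub_one hk'.ne', ← Real.rpow_mul hk'.le, mul_assoc, ← Real.rpow_add hk']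
        have e : (1 / τ - 1) * -τ + (1 - τ) = 0 := by field_simp; ring
        rw [e, Real.rpow_zero, mul_one]

/-- First differential inequality of Lemma A.4:
`−Δϖ_{r,N−2} ≥ C σ_k^{1−4τ₁/(N−2)} ϖ_{r,N−2}^{2^*−1}` outside `P₁`. -/
theorem varpi_superharmonic_estimate
    (N : ℕ) (hN : 5 ≤ N)
    (p : ℝ) (hp : p = 2 * N / ((N : ℝ) - 2))
    (m : ℝ) (hm1 : 2 ≤ m) (hm2 : m < (N : ℝ) - 2)
    (τ1 : ℝ) (hτ1 : τ1 = ((N : ℝ) - 2 - m) / ((N : ℝ) - 2))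
    (r0 : ℝ) (hr0 : 0 < r0) :
    ∃ C : ℝ, 0 < C ∧ ∃ k0 : ℕ,
      ∀ k : ℕ, k0 ≤ k →
        ∀ r ∈ Set.Icc (r0 * (k : ℝ) ^ (1 / τ1) - 1) (r0 * (k : ℝ) ^ (1 / τ1) + 1),
          ∀ y : EuclideanSpace ℝ (Fin N),
            y ∉ (⋃ i ∈ Finset.Icc 1 k,
                  Metric.ball (circlePt N k r i) ((k : ℝ) ^ (1 / ((N : ℝ) - 2)))) →
              C * ((k : ℝ) ^ (1 / ((N : ℝ) - 2))) ^ (1 - 4 * τ1 / ((N : ℝ) - 2)) *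
                  varpi N k r ((N : ℝ) - 2) y ^ (p - 1) ≤
                -laplacian (varpi N k r ((N : ℝ) - 2)) y := by
  have hN' : (5 : ℝ) ≤ N := by exact_mod_cast hN
  obtain ⟨n, hn⟩ : ∃ n : ℝ, n = (N : ℝ) - 2 := ⟨_, rfl⟩
  have hn3 : 3 ≤ n := by linarith
  have hn0 : 0 < n := by linarith
  have hτpos : 0 < τ1 := by rw [hτ1]; exact div_pos (by linarith) (by linarith)
  have hτn : τ1 * n = n - m := by rw [hτ1, ← hn]; field_simp
  have hτlt : τ1 < 1 := by nlinarith
  have hτle : τ1 ≤ n / 4 := by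
    rw [le_div_iff₀ four_pos]; nlinarith [sq_nonneg (n - 2)]
  have h1' : 0 < 1 - τ1 := by linarith
  have hp1 : p - 1 = 1 + 4 / n := by
    rw [hp, ← hn, show (N : ℝ) = n + 2 by linarith]; field_simp; ring
  set K : ℝ := 1 + 4 * (r0 ^ (-τ1) / (1 - τ1)) with hK
  have hKpos : 0 < K := by positivity
  refine ⟨(K ^ (4 / n))⁻¹, by positivity, max 1 ⌈2 / r0⌉₊, fun k hk r hr y hy => ?_⟩
  have hk1 : 1 ≤ k := (le_max_left _ _).trans hk
  have hk1' : (1 : ℝ) ≤ k := by exact_mod_cast hk1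
  have hk2 : 2 ≤ r0 * k := by
    have h : 2 / r0 ≤ k := (Nat.le_ceil _).trans (by exact_mod_cast (le_max_right _ _).trans hk)
    rwa [div_le_iff₀' hr0] at h
  have hrad : r0 * (k : ℝ) ^ (1 / τ1) ≤ 2 * r := by
    have h : (k : ℝ) ≤ (k : ℝ) ^ (1 / τ1) :=
      Real.self_le_rpow_of_one_le hk1' (by rw [le_div_iff₀ hτpos]; linarith)
    have := mul_le_mul_of_nonneg_left h hr0.le
    linarith [hr.1]
  rw [← hn] at hy ⊢
  set σ : ℝ := (k : ℝ) ^ (1 / n) with hσ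
  have hσpos : 0 < σ := by positivity
  have hdist (i : ℕ) (hi : i ∈ Finset.Icc 1 k) : σ ≤ ‖y - circlePt N k r i‖ := by
    by_contra! h
    exact hy (Set.mem_biUnion hi (by rwa [Metric.mem_ball, dist_eq_norm]))
  have hne (i : ℕ) (hi : i ∈ Finset.Icc 1 k) : y ≠ circlePt N k r i := fun h =>
    absurd (hdist i hi) (by simpa [h] using hσpos)
  set a : ℕ → ℝ := fun i => 1 + ‖y - circlePt N k r i‖ with ha
  have hapos (i : ℕ) : 0 < a i := by positivity
  have hquarter : ∑ i ∈ Finset.Icc 1 k, a i ^ (-(n / 4)) ≤ σ ^ (-(n / 4 - τ1)) * K := by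
    refine le_trans ?_ (mul_le_mul_of_nonneg_left
      (sum_rpow_neg_le_of_le_radius (by omega : 2 ≤ N) hk1 hr0 hτpos hτlt hrad y) (by positivity))
    rw [Finset.mul_sum]
    refine Finset.sum_le_sum fun i hi => ?_
    rw [show -(n / 4) = -(n / 4 - τ1) + -τ1 by ring, Real.rpow_add (hapos i)]
    refine mul_le_mul_of_nonneg_right (Real.rpow_le_rpow_of_nonpos hσpos ?_ (by linarith))
      (by positivity)
    linarith [hdist i hi]
  have hholder := sum_rpow_neg_rpow_le (Finset.Icc 1 k) hapos hn0
  have hS : 0 ≤ ∑ i ∈ Finset.Icc 1 k, a i ^ (-(n + 3)) :=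
    Finset.sum_nonneg fun i _ => (Real.rpow_pos_of_pos (hapos i) _).le
  have hweight : (∑ i ∈ Finset.Icc 1 k, a i ^ (-(n / 4))) ^ (4 / n) ≤
      σ ^ (-(1 - 4 * τ1 / n)) * K ^ (4 / n) := by
    refine (Real.rpow_le_rpow (Finset.sum_nonneg fun i _ =>
      (Real.rpow_pos_of_pos (hapos i) _).le) hquarter (by positivity)).trans_eq ?_
    rw [Real.mul_rpow (by positivity) hKpos.le, ← Real.rpow_mul hσpos.le]
    congr 2
    field_simp
  have hlap : ∑ i ∈ Finset.Icc 1 k, a i ^ (-(n + 3)) ≤ -laplacian (varpi N k r n) y := by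
    rw [hn, neg_laplacian_varpi hne, Finset.mul_sum]
    refine Finset.sum_le_sum fun i hi => ?_
    have hρ : 0 < ‖y - circlePt N k r i‖ := hσpos.trans_le (hdist i hi)
    have hNpos : 0 < a i ^ (-(N : ℝ)) := Real.rpow_pos_of_pos (hapos i) _
    rw [show -((N : ℝ) - 2 + 3) = -(N : ℝ) - 1 by ring, Real.rpow_sub_one (hapos i).ne']
    calc a i ^ (-(N : ℝ)) / a i ≤ a i ^ (-(N : ℝ)) / ‖y - circlePt N k r i‖ := by
          gcongr
          exact le_add_of_nonneg_left zero_le_one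
      _ ≤ _ := le_mul_of_one_le_left (by positivity) (by nlinarith)
  calc (K ^ (4 / n))⁻¹ * σ ^ (1 - 4 * τ1 / n) * varpi N k r n y ^ (p - 1)
      ≤ (K ^ (4 / n))⁻¹ * σ ^ (1 - 4 * τ1 / n) *
          (σ ^ (-(1 - 4 * τ1 / n)) * K ^ (4 / n) *
            ∑ i ∈ Finset.Icc 1 k, a i ^ (-(n + 3))) := by
        rw [hp1]
        exact mul_le_mul_of_nonneg_left
          (hholder.trans (mul_le_mul_of_nonneg_right hweight hS)) (by positivity)
    _ = ∑ i ∈ Finset.Icc 1 k, a i ^ (-(n + 3)) := by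
        rw [Real.rpow_neg hσpos.le]
        field_simp
    _ ≤ _ := hlap
end
end

section
/- Let N ≥ 5 be an integer, 2* = 2N/(N−2), and let K1 : (0,∞) → (0,∞) be a bounded function satisfying the (𝕂)-expansion at r0 > 0 with exponent m ∈ [2, N−2); set τ1 = (N−2−m)/(N−2), and fix 0 < γ1 < γ2. Then there exist θ > 0, C > 0 and an integer k0 such that for every integer k ≥ k0, setting μ = k^{1/τ1}, for every λ ∈ [γ1, γ2], every r ∈ [r0 μ − 1, r0 μ + 1] and every y ∈ ℝ^N: | K1(|y|/μ) U_{r,λ}(y)^{2*−1} − Σ_{i=1}^k U_{x^i,λ}(y)^{2*−1} | ≤ C μ^{−(m/2 + θ)} Σ_{i=1}^k (1 + |y − x^i|)^{−(N/2 + 2)}. -/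
noncomputable section

/-- (𝕂)-expansion of `K1` at `r0` with exponent `m`. -/
def AssumptionK1 (K1 : ℝ → ℝ) (r0 m : ℝ) : Prop :=
  ∃ c01 θ1 δ C0 : ℝ, 0 < c01 ∧ 0 < θ1 ∧ 0 < δ ∧ 0 < C0 ∧
    ∀ r ∈ Set.Ioo (r0 - δ) (r0 + δ),
      |K1 r - (1 - c01 * |r - r0| ^ m)| ≤ C0 * |r - r0| ^ (m + θ1)

/-- The standard bubble `U_{x,λ}`. -/
noncomputable def bubble (N : ℕ) (x : EuclideanSpace ℝ (Fin N)) (l : ℝ)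
    (y : EuclideanSpace ℝ (Fin N)) : ℝ :=
  ((N : ℝ) * ((N : ℝ) - 2)) ^ (((N : ℝ) - 2) / 4) *
    (l / (1 + l ^ 2 * ‖y - x‖ ^ 2)) ^ (((N : ℝ) - 2) / 2)

/-- `U_{r,λ} = Σ_{i=1}^k U_{x^i,λ}`. -/
noncomputable def multiBubble (N k : ℕ) (r l : ℝ) (y : EuclideanSpace ℝ (Fin N)) : ℝ :=
  ∑ i ∈ Finset.Icc 1 k, bubble N (circlePt N k r i) l y

theorem rpow_add_le_rpow_add_mul {a b q : ℝ} (ha : 0 ≤ a) (hb : 0 ≤ b) (hq : 1 ≤ q) :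
    (a + b) ^ q ≤ a ^ q + q * 2 ^ (q - 1) * (b * a ^ (q - 1) + b ^ q) := by
  have hq0 : q ≠ 0 := by linarith
  have hq1 : 0 ≤ q - 1 := by linarith
  rcases (add_nonneg ha hb).eq_or_lt with h0 | h0
  · have ha' : a = 0 := by linarith
    have hb' : b = 0 := by linarith
    simp [ha', hb', Real.zero_rpow hq0]
  have hsplit : ∀ x : ℝ, 0 ≤ x → x ^ q = x * x ^ (q - 1) := by
    intro x hx
    rw [← Real.rpow_one_add' hx (by linarith)]
    congr 1
    ring
  have hbern : (a + b) ^ q ≤ a ^ q + q * b * (a + b) ^ (q - 1) := by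
    have hle : b / (a + b) ≤ 1 := (div_le_one h0).2 (by linarith)
    have h := one_add_mul_self_le_rpow_one_add (s := -(b / (a + b))) (by linarith) hq
    have h1 : 1 + -(b / (a + b)) = a / (a + b) := by field_simp; ring
    rw [h1, Real.div_rpow ha h0.le] at h
    have hpos : 0 < (a + b) ^ q := Real.rpow_pos_of_pos h0 q
    rw [le_div_iff₀ hpos] at h
    have h2 : q * -(b / (a + b)) * (a + b) ^ q = -(q * b * (a + b) ^ (q - 1)) := by
      rw [hsplit _ h0.le]
      field_simp
    linarith
  have hmax : (a + b) ^ (q - 1) ≤ 2 ^ (q - 1) * (a ^ (q - 1) + b ^ (q - 1)) := by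
    have ha1 : 0 ≤ a ^ (q - 1) := Real.rpow_nonneg ha _
    have hb1 : 0 ≤ b ^ (q - 1) := Real.rpow_nonneg hb _
    rcases le_total a b with h | h
    · calc (a + b) ^ (q - 1) ≤ (2 * b) ^ (q - 1) := by gcongr; linarith
        _ = 2 ^ (q - 1) * b ^ (q - 1) := Real.mul_rpow (by norm_num) hb
        _ ≤ _ := by gcongr; linarith
    · calc (a + b) ^ (q - 1) ≤ (2 * a) ^ (q - 1) := by gcongr; linarith
        _ = 2 ^ (q - 1) * a ^ (q - 1) := Real.mul_rpow (by norm_num) ha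
        _ ≤ _ := by gcongr; linarith
  calc (a + b) ^ q ≤ a ^ q + q * b * (a + b) ^ (q - 1) := hbern
    _ ≤ a ^ q + q * b * (2 ^ (q - 1) * (a ^ (q - 1) + b ^ (q - 1))) := by gcongr
    _ = _ := by rw [hsplit b hb]; ring

theorem sum_rpow_le_sum_rpow {ι : Type*} (s : Finset ι) {f : ι → ℝ} (hf : ∀ i ∈ s, 0 ≤ f i)
    {q : ℝ} (hq : 1 ≤ q) : ∑ i ∈ s, f i ^ q ≤ (∑ i ∈ s, f i) ^ q := by
  have hsplit : ∀ x : ℝ, 0 ≤ x → x ^ q = x * x ^ (q - 1) := by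
    intro x hx
    rw [← Real.rpow_one_add' hx (by linarith)]
    congr 1
    ring
  rw [hsplit _ (Finset.sum_nonneg hf), Finset.sum_mul]
  refine Finset.sum_le_sum fun i hi => ?_
  rw [hsplit _ (hf i hi)]
  exact mul_le_mul_of_nonneg_left (Real.rpow_le_rpow (hf i hi)
    (Finset.single_le_sum hf hi) (by linarith)) (hf i hi)

theorem bubble_nonneg {N : ℕ} (hN : 2 ≤ N) (x y : EuclideanSpace ℝ (Fin N)) {l : ℝ} (hl : 0 ≤ l) :
    0 ≤ bubble N x l y := by
  have hN' : (2 : ℝ) ≤ N := by exact_mod_cast hN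
  unfold bubble
  have : 0 ≤ (N : ℝ) * ((N : ℝ) - 2) := mul_nonneg (by linarith) (by linarith)
  positivity

theorem bubble_le_rpow {N : ℕ} (hN : 2 ≤ N) {γ1 γ2 : ℝ} (hγ1 : 0 < γ1) (hγ2 : 0 < γ2) :
    ∃ B : ℝ, 0 < B ∧ ∀ l ∈ Set.Icc γ1 γ2, ∀ x y : EuclideanSpace ℝ (Fin N),
      bubble N x l y ≤ B * (1 + ‖y - x‖) ^ (-((N : ℝ) - 2)) := by
  have hN' : (2 : ℝ) ≤ N := by exact_mod_cast hN
  set c := ((N : ℝ) * ((N : ℝ) - 2)) ^ (((N : ℝ) - 2) / 4) with hc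
  have hc0 : 0 ≤ c := Real.rpow_nonneg (mul_nonneg (by linarith) (by linarith)) _
  set g := min 1 (γ1 ^ 2) with hg
  have hg0 : 0 < g := lt_min one_pos (by positivity)
  set A := 2 * γ2 / g with hA
  have hA0 : 0 < A := by positivity
  refine ⟨c * A ^ (((N : ℝ) - 2) / 2) + 1, by positivity, fun l hl x y => ?_⟩
  set t := ‖y - x‖ with ht
  have ht0 : 0 ≤ t := norm_nonneg _
  have hl0 : 0 < l := hγ1.trans_le hl.1
  have hbase : l / (1 + l ^ 2 * t ^ 2) ≤ A * (1 + t) ^ (-2 : ℝ) := by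
    have h1 : g * (1 + t ^ 2) ≤ 1 + l ^ 2 * t ^ 2 := by
      have h2 : g ≤ 1 := min_le_left _ _
      have h3 : g ≤ l ^ 2 := (min_le_right _ _).trans (pow_le_pow_left₀ hγ1.le hl.1 2)
      nlinarith [mul_le_mul_of_nonneg_right h3 (sq_nonneg t)]
    have h4 : (1 + t) ^ (-2 : ℝ) = 1 / (1 + t) ^ 2 := by
      rw [Real.rpow_neg (by linarith)]
      norm_num
    rw [h4, hA, div_mul_div_comm, mul_one]
    rw [div_le_div_iff₀ (by positivity) (by positivity)]
    have h5 : (1 + t) ^ 2 ≤ 2 * (1 + t ^ 2) := by nlinarith [sq_nonneg (1 - t)]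
    calc l * (g * (1 + t) ^ 2) ≤ γ2 * (g * (2 * (1 + t ^ 2))) := by
          gcongr
          exact hl.2
      _ = 2 * γ2 * (g * (1 + t ^ 2)) := by ring
      _ ≤ _ := by gcongr
  calc bubble N x l y = c * (l / (1 + l ^ 2 * t ^ 2)) ^ (((N : ℝ) - 2) / 2) := rfl
    _ ≤ c * (A * (1 + t) ^ (-2 : ℝ)) ^ (((N : ℝ) - 2) / 2) := by
        gcongr
    _ = c * A ^ (((N : ℝ) - 2) / 2) * (1 + t) ^ (-((N : ℝ) - 2)) := by
        rw [Real.mul_rpow hA0.le (by positivity), ← Real.rpow_mul (by linarith)]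
        rw [mul_assoc]
        congr 3
        ring
    _ ≤ _ := by gcongr; linarith

theorem norm_circlePt {N : ℕ} (hN : 2 ≤ N) (k : ℕ) {r : ℝ} (hr : 0 ≤ r) (i : ℕ) :
    ‖circlePt N k r i‖ = r := by
  obtain ⟨n, rfl⟩ := Nat.exists_eq_add_of_le' hN
  rw [EuclideanSpace.norm_eq, Real.sqrt_eq_iff_mul_self_eq (by positivity) hr]
  simp only [circlePt, Fin.sum_univ_succ, Real.norm_eq_abs, sq_abs]
  simp [Fin.val_succ]
  nlinarith [Real.sin_sq_add_cos_sq (2 * Real.pi * ((i : ℝ) - 1) / k)]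

theorem norm_circlePt_sub_circlePt {N : ℕ} (hN : 2 ≤ N) (k : ℕ) {r : ℝ} (hr : 0 ≤ r) (i j : ℕ) :
    ‖circlePt N k r i - circlePt N k r j‖ =
      2 * r * |Real.sin (Real.pi * ((i : ℝ) - j) / k)| := by
  obtain ⟨n, rfl⟩ := Nat.exists_eq_add_of_le' hN
  rw [EuclideanSpace.norm_eq, Real.sqrt_eq_iff_mul_self_eq (by positivity) (by positivity)]
  simp only [circlePt, Fin.sum_univ_succ, Real.norm_eq_abs, sq_abs]
  simp [Fin.val_succ]
  set a := 2 * Real.pi * ((i : ℝ) - 1) / k with ha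
  set b := 2 * Real.pi * ((j : ℝ) - 1) / k with hb
  have hab : Real.pi * ((i : ℝ) - j) / k = (a - b) / 2 := by rw [ha, hb]; ring
  rw [hab]
  have h1 : |Real.sin ((a - b) / 2)| * |Real.sin ((a - b) / 2)| = 1 / 2 - Real.cos (a - b) / 2 := by
    rw [abs_mul_abs_self, ← sq, Real.sin_sq_eq_half_sub]
    congr 3
    ring
  rw [Real.cos_sub] at h1
  have h2 := Real.sin_sq_add_cos_sq a
  have h3 := Real.sin_sq_add_cos_sq b
  linear_combination -4 * r ^ 2 * h1 + r ^ 2 * h2 + r ^ 2 * h3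

theorem exists_shift_le_abs_sin {k : ℕ} (hk : 0 < k) {l : ℤ} (hl0 : l ≠ 0) (hlk : |l| < k) :
    ∃ l' : ℤ, l' ≠ 0 ∧ (l' = l ∨ l' = l - k ∨ l' = l + k) ∧
      2 * |(l' : ℝ)| / k ≤ |Real.sin (Real.pi * l / k)| := by
  have hk' : (0 : ℝ) < k := by exact_mod_cast hk
  obtain ⟨hlk1, hlk2⟩ := abs_lt.1 hlk
  have key : ∀ l' : ℤ, 2 * |l'| ≤ k → 2 * |(l' : ℝ)| / k ≤ |Real.sin (Real.pi * l' / k)| := by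
    intro l' h
    have h' : 2 * |(l' : ℝ)| ≤ k := by exact_mod_cast h
    have habs : |Real.pi * l' / k| = Real.pi * |(l' : ℝ)| / k := by
      rw [abs_div, abs_mul, abs_of_pos Real.pi_pos, abs_of_pos hk']
    refine le_trans (le_of_eq ?_) (Real.mul_abs_le_abs_sin (x := Real.pi * l' / k) ?_)
    · rw [habs]
      field_simp
    · rw [habs, div_le_div_iff₀ hk' two_pos]
      nlinarith [Real.pi_pos]
  rcases le_or_gt (2 * |l|) k with h | h
  · exact ⟨l, hl0, Or.inl rfl, key l h⟩
  rcases le_total 0 l with hs | hs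
  · rw [abs_of_nonneg hs] at h
    refine ⟨l - k, by omega, Or.inr (Or.inl rfl), ?_⟩
    have := key (l - k) (by rw [abs_of_neg (by omega)]; omega)
    have hsin : Real.pi * ((l - k : ℤ) : ℝ) / k = Real.pi * l / k - Real.pi := by
      push_cast
      field_simp
    rwa [hsin, Real.sin_sub_pi, abs_neg] at this
  · rw [abs_of_nonpos hs] at h
    refine ⟨l + k, by omega, Or.inr (Or.inr rfl), ?_⟩
    have := key (l + k) (by rw [abs_of_pos (by omega)]; omega)
    have hsin : Real.pi * ((l + k : ℤ) : ℝ) / k = Real.pi * l / k + Real.pi := by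
      push_cast
      field_simp
    rwa [hsin, Real.sin_add_pi, abs_neg] at this

theorem sum_abs_sub_add_rpow_le_tsum (s : Finset ℕ) (i : ℕ) (a : ℤ) {α : ℝ} (hα : 1 < α) :
    ∑ j ∈ s, |(((i : ℤ) - j + a : ℤ) : ℝ)| ^ (-α) ≤ ∑' n : ℤ, |(n : ℝ)| ^ (-α) := by
  have hinj : Set.InjOn (fun j : ℕ => (i : ℤ) - j + a) s := by
    intro x _ y _ h
    simp only at h
    omega
  rw [← Finset.sum_image (f := fun n : ℤ => |(n : ℝ)| ^ (-α)) hinj]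
  exact (Real.summable_abs_int_rpow hα).sum_le_tsum _ fun n _ => by positivity

theorem sum_norm_sub_circlePt_rpow_le {N : ℕ} (hN : 2 ≤ N) {α : ℝ} (hα : 1 < α) :
    ∃ S : ℝ, 0 < S ∧ ∀ (k : ℕ) (r : ℝ), 0 < r → ∀ i ∈ Finset.Icc 1 k,
      ∀ y : EuclideanSpace ℝ (Fin N),
      (∀ j ∈ Finset.Icc 1 k, ‖y - circlePt N k r i‖ ≤ ‖y - circlePt N k r j‖) →
      ∀ β : ℝ, α ≤ β →
      ∑ j ∈ (Finset.Icc 1 k).erase i, (1 + ‖y - circlePt N k r j‖) ^ (-β) ≤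
        S * (k / r) ^ α * (1 + ‖y - circlePt N k r i‖) ^ (-(β - α)) := by
  set Z := ∑' n : ℤ, |(n : ℝ)| ^ (-α) with hZ
  have hZ0 : 0 ≤ Z := tsum_nonneg fun n => by positivity
  refine ⟨3 * Z + 1, by positivity, fun k r hr i hi y hmin β hβ => ?_⟩
  have hi' := Finset.mem_Icc.1 hi
  have hk : 0 < k := by omega
  have hk' : (0 : ℝ) < k := by exact_mod_cast hk
  set s := 1 + ‖y - circlePt N k r i‖ with hs
  have hs0 : 0 < s := by positivity
  set F : ℕ → ℤ → ℝ := fun j a => |(((i : ℤ) - j + a : ℤ) : ℝ)| ^ (-α) with hF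
  have hF0 : ∀ j a, 0 ≤ F j a := fun j a => by positivity
  have hterm : ∀ j ∈ (Finset.Icc 1 k).erase i, (1 + ‖y - circlePt N k r j‖) ^ (-β) ≤
      (k / r) ^ α * s ^ (-(β - α)) * (F j 0 + F j (-k) + F j k) := by
    intro j hj
    obtain ⟨hji, hj⟩ := Finset.mem_erase.1 hj
    have hj' := Finset.mem_Icc.1 hj
    set t := 1 + ‖y - circlePt N k r j‖ with ht
    have ht0 : 0 < t := by positivity
    have hst : s ≤ t := by linarith [hmin j hj]
    obtain ⟨l, hl0, hl, hsin⟩ := exists_shift_le_abs_sin hk (l := (i : ℤ) - j) (by omega)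
      (by rw [abs_lt]; omega)
    have hlF : |(l : ℝ)| ^ (-α) ≤ F j 0 + F j (-k) + F j k := by
      have h1 := hF0 j 0
      have h2 := hF0 j (-k)
      have h3 := hF0 j k
      rcases hl with h | h | h
      · have : |(l : ℝ)| ^ (-α) = F j 0 := by rw [hF, h]; simp
        linarith
      · have : |(l : ℝ)| ^ (-α) = F j (-k) := by rw [hF, h, sub_eq_add_neg _ (k : ℤ)]
        linarith
      · have : |(l : ℝ)| ^ (-α) = F j k := by rw [hF, h]
        linarith
    have hlpos : 0 < |(l : ℝ)| := abs_pos.2 (by exact_mod_cast hl0)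
    have htl : r / k * |(l : ℝ)| ≤ t := by
      have h1 := norm_circlePt_sub_circlePt hN k hr.le i j
      have h2 : ‖circlePt N k r i - circlePt N k r j‖ ≤
          ‖y - circlePt N k r i‖ + ‖y - circlePt N k r j‖ := by
        rw [norm_sub_rev y (circlePt N k r i)]
        exact norm_sub_le_norm_sub_add_norm_sub _ _ _
      have h3 := hmin j hj
      push_cast at hsin
      have h4 : r * (2 * |(l : ℝ)| / k) ≤ r * |Real.sin (Real.pi * ((i : ℝ) - j) / k)| := by
        gcongr
      have h5 : r * (2 * |(l : ℝ)| / k) = 2 * (r / k * |(l : ℝ)|) := by ring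
      have h6 : 0 < r / k * |(l : ℝ)| := by positivity
      linarith
    have h1 : t ^ (-α) ≤ (k / r) ^ α * |(l : ℝ)| ^ (-α) := by
      calc t ^ (-α) ≤ (r / k * |(l : ℝ)|) ^ (-α) :=
            Real.rpow_le_rpow_of_nonpos (by positivity) htl (by linarith)
        _ = (k / r) ^ α * |(l : ℝ)| ^ (-α) := by
            rw [Real.mul_rpow (by positivity) hlpos.le, Real.rpow_neg (by positivity),
              ← Real.inv_rpow (by positivity), inv_div]
    have h2 : t ^ (-(β - α)) ≤ s ^ (-(β - α)) :=
      Real.rpow_le_rpow_of_nonpos hs0 hst (by linarith)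
    calc t ^ (-β) = t ^ (-α) * t ^ (-(β - α)) := by
          rw [← Real.rpow_add ht0]; congr 1; ring
      _ ≤ ((k / r) ^ α * |(l : ℝ)| ^ (-α)) * s ^ (-(β - α)) := by gcongr
      _ = (k / r) ^ α * s ^ (-(β - α)) * |(l : ℝ)| ^ (-α) := by ring
      _ ≤ _ := by gcongr
  have hFsum : ∀ a : ℤ, ∑ j ∈ (Finset.Icc 1 k).erase i, F j a ≤ Z :=
    fun a => sum_abs_sub_add_rpow_le_tsum _ i a hα
  calc _ ≤ ∑ j ∈ (Finset.Icc 1 k).erase i,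
        (k / r) ^ α * s ^ (-(β - α)) * (F j 0 + F j (-k) + F j k) := Finset.sum_le_sum hterm
    _ = (k / r) ^ α * s ^ (-(β - α)) * (∑ j ∈ (Finset.Icc 1 k).erase i, F j 0 +
        ∑ j ∈ (Finset.Icc 1 k).erase i, F j (-k) + ∑ j ∈ (Finset.Icc 1 k).erase i, F j k) := by
        rw [← Finset.mul_sum, Finset.sum_add_distrib, Finset.sum_add_distrib]
    _ ≤ (k / r) ^ α * s ^ (-(β - α)) * (3 * Z + 1) := by
        refine mul_le_mul_of_nonneg_left ?_ (by positivity)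
        linarith [hFsum 0, hFsum (-k), hFsum k]
    _ = _ := by ring

theorem AssumptionK1.abs_sub_one_le {K1 : ℝ → ℝ} {r0 m : ℝ} (hK : AssumptionK1 K1 r0 m) {M : ℝ}
    (hM : ∀ ρ, 0 ≤ ρ → |K1 ρ| ≤ M) {e : ℝ} (he0 : 0 ≤ e) (hem : e ≤ m) :
    ∃ C : ℝ, 0 < C ∧ ∀ ρ, 0 ≤ ρ → |K1 ρ - 1| ≤ C * |ρ - r0| ^ e := by
  obtain ⟨c, θ, δ, C0, hc, hθ, hδ, hC0, h⟩ := hK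
  have hM0 : 0 ≤ M := (abs_nonneg _).trans (hM 0 le_rfl)
  set d := min δ 1 with hd
  have hd0 : 0 < d := lt_min hδ one_pos
  refine ⟨c + C0 + (M + 1) * d ^ (-e), by positivity, fun ρ hρ => ?_⟩
  set t := |ρ - r0| with ht
  have ht0 : 0 ≤ t := abs_nonneg _
  rcases lt_or_ge t d with htd | htd
  · have ht1 : t ≤ 1 := htd.le.trans (min_le_right _ _)
    have hmem : ρ ∈ Set.Ioo (r0 - δ) (r0 + δ) := by
      have := abs_lt.1 (htd.trans_le (min_le_left _ _))
      constructor <;> linarith [this.1, this.2]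
    have h1 := h ρ hmem
    have h2 : t ^ m ≤ t ^ e := Real.rpow_le_rpow_of_exponent_ge' ht0 ht1 he0 hem
    have h3 : t ^ (m + θ) ≤ t ^ e :=
      Real.rpow_le_rpow_of_exponent_ge' ht0 ht1 he0 (by linarith)
    have h4 : |K1 ρ - 1| ≤ |K1 ρ - (1 - c * t ^ m)| + c * t ^ m := by
      have h5 : 0 ≤ c * t ^ m := by positivity
      have h6 := abs_sub_le (K1 ρ) (1 - c * t ^ m) 1
      rwa [sub_sub_cancel_left, abs_neg, abs_of_nonneg h5] at h6
    calc |K1 ρ - 1| ≤ C0 * t ^ (m + θ) + c * t ^ m := h4.trans (by linarith)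
      _ ≤ C0 * t ^ e + c * t ^ e := by gcongr
      _ = (c + C0) * t ^ e := by ring
      _ ≤ _ := mul_le_mul_of_nonneg_right (le_add_of_nonneg_right (by positivity)) (by positivity)
  · have h1 : 1 ≤ d ^ (-e) * t ^ e := by
      rw [Real.rpow_neg hd0.le, ← div_eq_inv_mul, one_le_div (by positivity)]
      gcongr
    calc |K1 ρ - 1| ≤ |K1 ρ| + |1| := abs_sub _ _
      _ ≤ M + 1 := by rw [abs_one]; linarith [hM ρ hρ]
      _ ≤ (M + 1) * (d ^ (-e) * t ^ e) := le_mul_of_one_le_right (by positivity) h1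
      _ = (M + 1) * d ^ (-e) * t ^ e := by ring
      _ ≤ _ := mul_le_mul_of_nonneg_right (le_add_of_nonneg_left (by positivity)) (by positivity)

theorem multiBubble_rpow_sub_sum_rpow_le {N : ℕ} (hN : 5 ≤ N) {γ1 γ2 : ℝ} (hγ1 : 0 < γ1)
    (hγ2 : 0 < γ2) {q : ℝ} (hq : q = ((N : ℝ) + 2) / ((N : ℝ) - 2)) :
    ∃ C : ℝ, 0 < C ∧ ∀ l ∈ Set.Icc γ1 γ2, ∀ (k : ℕ) (r : ℝ), 0 < r → ∀ i ∈ Finset.Icc 1 k,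
      ∀ y : EuclideanSpace ℝ (Fin N),
      (∀ j ∈ Finset.Icc 1 k, ‖y - circlePt N k r i‖ ≤ ‖y - circlePt N k r j‖) →
      multiBubble N k r l y ^ q - ∑ j ∈ Finset.Icc 1 k, bubble N (circlePt N k r j) l y ^ q ≤
        C * (k / r) ^ ((N : ℝ) / 2) *
          (1 + ‖y - circlePt N k r i‖) ^ (-((N : ℝ) / 2 + 2)) := by
  have hN' : (5 : ℝ) ≤ N := by exact_mod_cast hN
  have hN2 : 2 ≤ N := by omega
  have hn0 : (0 : ℝ) < (N : ℝ) - 2 := by linarith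
  have hq1 : 1 ≤ q := by rw [hq, one_le_div hn0]; linarith
  set β := (N : ℝ) * ((N : ℝ) - 2) / (2 * ((N : ℝ) + 2)) with hβ
  have hβ1 : 1 < β := by
    rw [hβ, one_lt_div (by linarith)]
    nlinarith
  have hβn : β ≤ (N : ℝ) - 2 := by
    rw [hβ, div_le_iff₀ (by linarith)]
    nlinarith
  have hβq : β * q = (N : ℝ) / 2 := by
    rw [hβ, hq]
    field_simp
  have hnq : ((N : ℝ) - 2) * q = (N : ℝ) + 2 := by
    rw [hq]
    field_simp
  obtain ⟨B, hB, hbub⟩ := bubble_le_rpow hN2 hγ1 hγ2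
  obtain ⟨S1, hS1, hsum1⟩ := sum_norm_sub_circlePt_rpow_le hN2 (α := (N : ℝ) / 2) (by linarith)
  obtain ⟨S2, hS2, hsum2⟩ := sum_norm_sub_circlePt_rpow_le hN2 hβ1
  refine ⟨q * 2 ^ (q - 1) * (B * S1 * B ^ (q - 1) + (B * S2) ^ q), by positivity,
    fun l hl k r hr i hi y hmin => ?_⟩
  have hl0 : 0 ≤ l := hγ1.le.trans hl.1
  have hu0 : ∀ j, 0 ≤ bubble N (circlePt N k r j) l y := fun j => bubble_nonneg hN2 _ _ hl0
  set s := 1 + ‖y - circlePt N k r i‖ with hs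
  have hs0 : 0 < s := by positivity
  set κ := (k : ℝ) / r with hκ
  have hκ0 : 0 ≤ κ := by positivity
  set u := bubble N (circlePt N k r i) l y with hu
  set R := ∑ j ∈ (Finset.Icc 1 k).erase i, bubble N (circlePt N k r j) l y with hR
  have hR0 : 0 ≤ R := Finset.sum_nonneg fun j _ => hu0 j
  have hV : multiBubble N k r l y = u + R := (Finset.add_sum_erase _ _ hi).symm
  have huG : u ^ q ≤ ∑ j ∈ Finset.Icc 1 k, bubble N (circlePt N k r j) l y ^ q :=
    Finset.single_le_sum (f := fun j => bubble N (circlePt N k r j) l y ^ q)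
      (fun j _ => Real.rpow_nonneg (hu0 j) q) hi
  have hRB : R ≤ B * ∑ j ∈ (Finset.Icc 1 k).erase i,
      (1 + ‖y - circlePt N k r j‖) ^ (-((N : ℝ) - 2)) := by
    rw [Finset.mul_sum]
    exact Finset.sum_le_sum fun j _ => hbub l hl _ _
  have hR1 : R ≤ B * S1 * κ ^ ((N : ℝ) / 2) * s ^ (-((N : ℝ) - 2 - N / 2)) := by
    refine hRB.trans ?_
    have := hsum1 k r hr i hi y hmin ((N : ℝ) - 2) (by linarith)
    calc _ ≤ B * (S1 * κ ^ ((N : ℝ) / 2) * s ^ (-((N : ℝ) - 2 - N / 2))) := by gcongr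
      _ = _ := by ring
  have hR2 : R ≤ B * S2 * κ ^ β * s ^ (-((N : ℝ) - 2 - β)) := by
    refine hRB.trans ?_
    have := hsum2 k r hr i hi y hmin ((N : ℝ) - 2) hβn
    calc _ ≤ B * (S2 * κ ^ β * s ^ (-((N : ℝ) - 2 - β))) := by gcongr
      _ = _ := by ring
  have hRq : R ^ q ≤ (B * S2) ^ q * (κ ^ ((N : ℝ) / 2) * s ^ (-((N : ℝ) / 2 + 2))) := by
    calc R ^ q ≤ (B * S2 * κ ^ β * s ^ (-((N : ℝ) - 2 - β))) ^ q :=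
          Real.rpow_le_rpow hR0 hR2 (by linarith)
      _ = (B * S2) ^ q * (κ ^ (β * q) * s ^ (-((N : ℝ) - 2 - β) * q)) := by
          rw [Real.mul_rpow (by positivity) (by positivity),
            Real.mul_rpow (by positivity) (by positivity), ← Real.rpow_mul hκ0,
            ← Real.rpow_mul hs0.le, mul_assoc]
      _ = _ := by
          rw [hβq]
          congr 3
          linear_combination hβq - hnq
  have hu1 : u ^ (q - 1) ≤ B ^ (q - 1) * s ^ (-4 : ℝ) := by
    calc u ^ (q - 1) ≤ (B * s ^ (-((N : ℝ) - 2))) ^ (q - 1) :=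
          Real.rpow_le_rpow (hu0 i) (hbub l hl _ _) (by linarith)
      _ = B ^ (q - 1) * s ^ (-((N : ℝ) - 2) * (q - 1)) := by
          rw [Real.mul_rpow hB.le (by positivity), ← Real.rpow_mul hs0.le]
      _ = _ := by
          congr 2
          linear_combination -hnq
  have hRu : R * u ^ (q - 1) ≤
      B * S1 * B ^ (q - 1) * (κ ^ ((N : ℝ) / 2) * s ^ (-((N : ℝ) / 2 + 2))) := by
    calc R * u ^ (q - 1) ≤ (B * S1 * κ ^ ((N : ℝ) / 2) * s ^ (-((N : ℝ) - 2 - N / 2))) *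
          (B ^ (q - 1) * s ^ (-4 : ℝ)) :=
          mul_le_mul hR1 hu1 (Real.rpow_nonneg (hu0 i) _) (by positivity)
      _ = B * S1 * B ^ (q - 1) * (κ ^ ((N : ℝ) / 2) *
          (s ^ (-((N : ℝ) - 2 - N / 2)) * s ^ (-4 : ℝ))) := by ring
      _ = _ := by
          rw [← Real.rpow_add hs0]
          congr 3
          ring
  have hmain := rpow_add_le_rpow_add_mul (hu0 i) hR0 hq1
  rw [hV]
  calc _ ≤ q * 2 ^ (q - 1) * (R * u ^ (q - 1) + R ^ q) := by linarith
    _ ≤ q * 2 ^ (q - 1) * (B * S1 * B ^ (q - 1) * (κ ^ ((N : ℝ) / 2) * s ^ (-((N : ℝ) / 2 + 2))) +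
        (B * S2) ^ q * (κ ^ ((N : ℝ) / 2) * s ^ (-((N : ℝ) / 2 + 2)))) := by gcongr
    _ = _ := by ring

/-- Lemma A.3: pointwise estimate of the error
`K1(|y|/μ) U_{r,λ}^{2^*−1} − Σ_i U_{x^i,λ}^{2^*−1}`. -/
theorem approximate_solution_error_pointwise
    (N : ℕ) (hN : 5 ≤ N)
    (p : ℝ) (hp : p = 2 * N / ((N : ℝ) - 2))
    (K1 : ℝ → ℝ) (hK1pos : ∀ r : ℝ, 0 < r → 0 < K1 r)
    (hK1bdd : ∃ M : ℝ, ∀ r : ℝ, 0 < r → K1 r ≤ M)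
    (r0 m : ℝ) (hr0 : 0 < r0) (hm1 : 2 ≤ m) (hm2 : m < (N : ℝ) - 2)
    (hK : AssumptionK1 K1 r0 m)
    (τ1 : ℝ) (hτ1 : τ1 = ((N : ℝ) - 2 - m) / ((N : ℝ) - 2))
    (γ1 γ2 : ℝ) (hγ1 : 0 < γ1) (hγ12 : γ1 < γ2) :
    ∃ θ : ℝ, 0 < θ ∧ ∃ C : ℝ, 0 < C ∧ ∃ k0 : ℕ,
      ∀ k : ℕ, k0 ≤ k →
        ∀ lam ∈ Set.Icc γ1 γ2,
        ∀ r ∈ Set.Icc (r0 * (k : ℝ) ^ (1 / τ1) - 1) (r0 * (k : ℝ) ^ (1 / τ1) + 1),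
        ∀ y : EuclideanSpace ℝ (Fin N),
          |K1 (‖y‖ / (k : ℝ) ^ (1 / τ1)) * multiBubble N k r lam y ^ (p - 1) -
              ∑ i ∈ Finset.Icc 1 k, bubble N (circlePt N k r i) lam y ^ (p - 1)| ≤
            C * ((k : ℝ) ^ (1 / τ1)) ^ (-(m / 2 + θ)) *
              ∑ i ∈ Finset.Icc 1 k,
                (1 + ‖y - circlePt N k r i‖) ^ (-((N : ℝ) / 2 + 2)) := by
  have hN' : (5 : ℝ) ≤ N := by exact_mod_cast hN
  have hN2 : 2 ≤ N := by omega
  have hn0 : (0 : ℝ) < (N : ℝ) - 2 := by linarith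
  have hγ2 : 0 < γ2 := hγ1.trans hγ12
  have hq : p - 1 = ((N : ℝ) + 2) / ((N : ℝ) - 2) := by
    rw [hp, eq_div_iff hn0.ne', sub_mul, div_mul_cancel₀ _ hn0.ne']
    ring
  set q := p - 1 with hqdef
  have hq1 : 1 ≤ q := by rw [hq, one_le_div hn0]; linarith
  have hnq : ((N : ℝ) - 2) * q = (N : ℝ) + 2 := by rw [hq, mul_div_cancel₀ _ hn0.ne']
  have hτ0 : 0 < τ1 := by rw [hτ1]; exact div_pos (by linarith) hn0
  have hτ_le : τ1 ≤ 1 := by rw [hτ1, div_le_one hn0]; linarith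
  set θ := m / ((N : ℝ) - 2) with hθ
  have hθ0 : 0 < θ := div_pos (by linarith) hn0
  have hθ1 : θ ≤ 1 := by rw [hθ, div_le_one hn0]; exact hm2.le
  have hθn : θ * ((N : ℝ) - 2) = m := div_mul_cancel₀ _ hn0.ne'
  have hτθ : τ1 - 1 = -θ := by
    rw [hτ1, hθ]
    field_simp
    ring
  obtain ⟨M, hM⟩ := hK1bdd
  obtain ⟨M', hM'⟩ : ∃ M' : ℝ, ∀ ρ, 0 ≤ ρ → |K1 ρ| ≤ M' := by
    refine ⟨max M |K1 0|, fun ρ hρ => ?_⟩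
    rcases hρ.eq_or_lt with rfl | h
    · exact le_max_right _ _
    · rw [abs_of_pos (hK1pos ρ h)]
      exact (hM ρ h).trans (le_max_left _ _)
  have hM'0 : 0 ≤ M' := (abs_nonneg _).trans (hM' 0 le_rfl)
  set e := m / 2 + θ with he
  have he0 : 0 ≤ e := by positivity
  have heN : e = θ * (N / 2) := by linear_combination -hθn / 2
  obtain ⟨CK, hCK, hKle⟩ := hK.abs_sub_one_le hM' he0 (by linarith)
  obtain ⟨B, hB, hbub⟩ := bubble_le_rpow hN2 hγ1 hγ2
  obtain ⟨D, hD, hinter⟩ := multiBubble_rpow_sub_sum_rpow_le hN hγ1 hγ2 hq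
  refine ⟨θ, hθ0, M' * (D * (2 / r0) ^ ((N : ℝ) / 2)) + CK * B ^ q, by positivity,
    ⌈2 / r0⌉₊ + 1, fun k hk lam hlam r hr y => ?_⟩
  have hk1 : (1 : ℝ) ≤ k := by exact_mod_cast (Nat.le_add_left 1 _).trans hk
  have hk2 : 2 / r0 ≤ k :=
    (Nat.le_ceil _).trans (by exact_mod_cast (Nat.le_add_right _ 1).trans hk)
  set μ := (k : ℝ) ^ (1 / τ1) with hμ
  have hμ0 : 0 < μ := by positivity
  have hkμ : (k : ℝ) ≤ μ := by
    calc (k : ℝ) = (k : ℝ) ^ (1 : ℝ) := (Real.rpow_one _).symm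
      _ ≤ μ := Real.rpow_le_rpow_of_exponent_le hk1 ((one_le_div hτ0).2 hτ_le)
  have hratio : (k : ℝ) / μ = μ ^ (-θ) := by
    have : (k : ℝ) = μ ^ τ1 := by
      rw [hμ, ← Real.rpow_mul (by positivity), one_div_mul_cancel hτ0.ne', Real.rpow_one]
    rw [← hτθ, Real.rpow_sub_one hμ0.ne', ← this]
  have hrμ : r0 * μ / 2 ≤ r := by
    have h1 : 2 ≤ r0 * μ := by
      have := hk2.trans hkμ
      rwa [div_le_iff₀' hr0] at this
    linarith [hr.1]
  have hr' : 0 < r := lt_of_lt_of_le (by positivity) hrμ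
  have hkr : ((k : ℝ) / r) ^ ((N : ℝ) / 2) ≤ (2 / r0) ^ ((N : ℝ) / 2) * μ ^ (-e) := by
    have h1 : (k : ℝ) / r ≤ 2 / r0 * μ ^ (-θ) := by
      rw [← hratio]
      calc (k : ℝ) / r ≤ k / (r0 * μ / 2) := by gcongr
        _ = 2 / r0 * (k / μ) := by field_simp
    calc ((k : ℝ) / r) ^ ((N : ℝ) / 2) ≤ (2 / r0 * μ ^ (-θ)) ^ ((N : ℝ) / 2) := by gcongr
      _ = _ := by
        rw [Real.mul_rpow (by positivity) (by positivity), ← Real.rpow_mul hμ0.le, heN, neg_mul]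
  set P := ∑ i ∈ Finset.Icc 1 k, (1 + ‖y - circlePt N k r i‖) ^ (-((N : ℝ) / 2 + 2)) with hP
  set G := ∑ i ∈ Finset.Icc 1 k, bubble N (circlePt N k r i) lam y ^ q with hG
  set V := multiBubble N k r lam y with hV
  set K := K1 (‖y‖ / μ) with hKdef
  have hu0 : ∀ i, 0 ≤ bubble N (circlePt N k r i) lam y :=
    fun i => bubble_nonneg hN2 _ _ (hγ1.le.trans hlam.1)
  have hG0 : 0 ≤ G := Finset.sum_nonneg fun i _ => Real.rpow_nonneg (hu0 i) q
  have hGV : G ≤ V ^ q := sum_rpow_le_sum_rpow _ (fun i _ => hu0 i) hq1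
  have hKM : |K| ≤ M' := hM' _ (by positivity)
  have hpart1 : V ^ q - G ≤ D * (2 / r0) ^ ((N : ℝ) / 2) * μ ^ (-e) * P := by
    obtain ⟨i, hi, hmin⟩ := Finset.exists_min_image (Finset.Icc 1 k)
      (fun j => ‖y - circlePt N k r j‖) ⟨1, by simpa using (Nat.le_add_left 1 _).trans hk⟩
    have hiP : (1 + ‖y - circlePt N k r i‖) ^ (-((N : ℝ) / 2 + 2)) ≤ P :=
      Finset.single_le_sum
        (f := fun j => (1 + ‖y - circlePt N k r j‖) ^ (-((N : ℝ) / 2 + 2)))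
        (fun j _ => by positivity) hi
    calc V ^ q - G ≤ D * (k / r) ^ ((N : ℝ) / 2) *
          (1 + ‖y - circlePt N k r i‖) ^ (-((N : ℝ) / 2 + 2)) :=
          hinter lam hlam k r hr' i hi y hmin
      _ ≤ D * ((2 / r0) ^ ((N : ℝ) / 2) * μ ^ (-e)) * P := by gcongr
      _ = _ := by ring
  have hpart2 : |K - 1| * G ≤ CK * B ^ q * μ ^ (-e) * P := by
    rw [hG, hP, Finset.mul_sum, Finset.mul_sum]
    refine Finset.sum_le_sum fun i _ => ?_
    set s := 1 + ‖y - circlePt N k r i‖ with hs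
    have hs1 : 1 ≤ s := le_add_of_nonneg_right (norm_nonneg _)
    have hs0 : 0 < s := by linarith
    have hdist : |‖y‖ / μ - r0| ≤ s / μ := by
      have h1 : ‖y‖ / μ - r0 = (‖y‖ - r0 * μ) / μ := by field_simp
      rw [h1, abs_div, abs_of_pos hμ0]
      gcongr
      have h2 := abs_norm_sub_norm_le y (circlePt N k r i)
      rw [norm_circlePt hN2 k hr'.le i] at h2
      have h3 := abs_le.1 h2
      rw [abs_le]
      constructor <;> linarith [hr.1, hr.2, h3.1, h3.2]
    have hK1 : |K - 1| ≤ CK * (s ^ e * μ ^ (-e)) := by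
      calc |K - 1| ≤ CK * |‖y‖ / μ - r0| ^ e := hKle _ (by positivity)
        _ ≤ CK * (s / μ) ^ e := by gcongr
        _ = _ := by rw [Real.div_rpow hs0.le hμ0.le, Real.rpow_neg hμ0.le, div_eq_mul_inv]
    have hu : bubble N (circlePt N k r i) lam y ^ q ≤ B ^ q * s ^ (-((N : ℝ) + 2)) := by
      calc _ ≤ (B * s ^ (-((N : ℝ) - 2))) ^ q :=
            Real.rpow_le_rpow (hu0 i) (hbub lam hlam _ _) (by linarith)
        _ = _ := by
          rw [Real.mul_rpow hB.le (by positivity), ← Real.rpow_mul hs0.le, neg_mul, hnq]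
    have hexp : s ^ e * s ^ (-((N : ℝ) + 2)) ≤ s ^ (-((N : ℝ) / 2 + 2)) := by
      rw [← Real.rpow_add hs0]
      refine Real.rpow_le_rpow_of_exponent_le hs1 ?_
      have : e ≤ 1 * (N / 2) := by rw [heN]; gcongr
      linarith
    calc |K - 1| * bubble N (circlePt N k r i) lam y ^ q
        ≤ CK * (s ^ e * μ ^ (-e)) * (B ^ q * s ^ (-((N : ℝ) + 2))) :=
          mul_le_mul hK1 hu (Real.rpow_nonneg (hu0 i) q) (by positivity)
      _ = CK * B ^ q * μ ^ (-e) * (s ^ e * s ^ (-((N : ℝ) + 2))) := by ring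
      _ ≤ _ := by gcongr
  calc |K * V ^ q - G| = |K * (V ^ q - G) + (K - 1) * G| := by congr 1; ring
    _ ≤ |K * (V ^ q - G)| + |(K - 1) * G| := abs_add_le _ _
    _ = |K| * (V ^ q - G) + |K - 1| * G := by
        rw [abs_mul, abs_mul, abs_of_nonneg (sub_nonneg.2 hGV), abs_of_nonneg hG0]
    _ ≤ M' * (D * (2 / r0) ^ ((N : ℝ) / 2) * μ ^ (-e) * P) + CK * B ^ q * μ ^ (-e) * P := by
        gcongr
    _ = _ := by ring
end
end
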